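/- arXiv:2601.01474 — 2 statements merged into one kernel-verified Lean document; each statement's English description precedes it below -/
import Mathlib

section
/- Let L > 0, d > 0 and let m ≥ 1 be an integer with m·d ≤ L. If θ_1, …, θ_m are independent random points, each uniformly distributed on a circle of circumference L (equivalently, on ℝ/Lℤ equipped with the arc-length metric dist(a,b) = min(|a−b|, L−|a−b|) on representatives in [0,L)), then the probability that every pair of distinct points is at arc-length distance at least d equals (1 − m·d/L)^{m−1}. -/
open MeasureTheory

namespace UncrowdedRoad

/-- The points of the circle at coordinates `x ∈ [0, L)`, re-coordinatised with origin `t`. -/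
noncomputable def rotate (L t x : ℝ) : ℝ := if x < t then x + (L - t) else x + -t

/-- Configurations of `n` points in `[a, b]` at pairwise distance at least `d`. -/
def separated (n : ℕ) (d a b : ℝ) : Set (Fin n → ℝ) :=
  {x | (∀ i, x i ∈ Set.Icc a b) ∧ ∀ i j, i ≠ j → d ≤ |x i - x j|}

/-- Configurations of `n` points whose strictly increasing order is given by `σ`. -/
def chamber {n : ℕ} (σ : Equiv.Perm (Fin n)) : Set (Fin n → ℝ) := {x | StrictMono (x ∘ σ)}

theorem measurableSet_chamber {n : ℕ} (σ : Equiv.Perm (Fin n)) : MeasurableSet (chamber σ) := by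
  simp only [chamber, StrictMono, Set.ofPred_forall]
  refine MeasurableSet.iInter fun i => MeasurableSet.iInter fun j => MeasurableSet.iInter fun _ => ?_
  exact measurableSet_lt (measurable_pi_apply _) (measurable_pi_apply _)

theorem measurableSet_separated (n : ℕ) (d a b : ℝ) : MeasurableSet (separated n d a b) := by
  unfold separated
  measurability

theorem pairwise_disjoint_chamber (n : ℕ) :
    Pairwise (Function.onFun Disjoint (chamber (n := n))) := by
  intro σ τ hst
  refine Set.disjoint_left.2 fun x (hσ : StrictMono (x ∘ σ)) (hτ : StrictMono (x ∘ τ)) => hst ?_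
  have hx : Function.Injective x := (Equiv.injective_comp σ x).1 hσ.injective
  exact Equiv.ext fun k => hx (congrFun (Tuple.unique_monotone hσ.monotone hτ.monotone) k)

theorem ae_injective (n : ℕ) : ∀ᵐ x : Fin n → ℝ, Function.Injective x := by
  have h : ∀ i j : Fin n, i ≠ j → ∀ᵐ x : Fin n → ℝ, x i ≠ x j := by
    intro i j hij
    let S : Submodule ℝ (Fin n → ℝ) :=
      LinearMap.ker ((LinearMap.proj i : (Fin n → ℝ) →ₗ[ℝ] ℝ) - LinearMap.proj j)
    have hS : S ≠ ⊤ := by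
      intro hS
      have : (Pi.single i 1 : Fin n → ℝ) ∈ S := hS ▸ Submodule.mem_top
      simp [S, Pi.single_eq_of_ne hij.symm] at this
    have h0 := Measure.addHaar_submodule (volume : Measure (Fin n → ℝ)) S hS
    refine measure_mono_null ?_ h0
    intro x hx
    simpa [S, sub_eq_zero] using hx
  have h' : ∀ᵐ x : Fin n → ℝ, ∀ i j : Fin n, i ≠ j → x i ≠ x j := by
    rw [ae_all_iff]; intro i
    rw [ae_all_iff]; intro j
    rw [ae_all_iff]; exact h i j
  filter_upwards [h'] with x hx i j hij
  by_contra hne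
  exact hx i j hne hij

theorem volume_eq_sum_chamber {n : ℕ} {S : Set (Fin n → ℝ)} (hS : MeasurableSet S) :
    volume S = ∑ σ : Equiv.Perm (Fin n), volume (S ∩ chamber σ) := by
  rw [← tsum_fintype (L := .unconditional _), ← measure_iUnion]
  · refine measure_congr ?_
    filter_upwards [ae_injective n] with x hx
    refine propext ⟨fun h => Set.mem_iUnion.2 ⟨Tuple.sort x, h, ?_⟩, fun h => ?_⟩
    · exact (Tuple.monotone_sort x).strictMono_of_injective (hx.comp (Tuple.sort x).injective)
    · obtain ⟨σ, h, -⟩ := Set.mem_iUnion.1 h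
      exact h
  · exact fun σ τ h => (pairwise_disjoint_chamber n h).mono
      Set.inter_subset_right Set.inter_subset_right
  · exact fun σ => hS.inter (measurableSet_chamber σ)

/-- Pushing the `k`-th smallest point to the right by `k * d` turns an ordered configuration in an
interval into an ordered configuration with gaps at least `d` in a longer interval. -/
theorem add_mem_separated_iff {n : ℕ} {d a b : ℝ} (hd : 0 < d) (σ : Equiv.Perm (Fin n))
    {x : Fin n → ℝ} (hx : Function.Injective x) :
    x + (fun i => d * ((σ.symm i : ℕ) : ℝ)) ∈ separated n d a b ∩ chamber σ ↔
      x ∈ Set.Icc (fun _ => a) (fun _ => b - ((n : ℝ) - 1) * d) ∩ chamber σ := by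
  have key : ∀ k, (x + (fun i => d * ((σ.symm i : ℕ) : ℝ))) (σ k) = x (σ k) + d * (k : ℕ) := by
    intro k; simp
  obtain _ | n := n
  · simp [separated, chamber, StrictMono, Set.mem_Icc]
  constructor
  · rintro ⟨⟨hI, hsep⟩, hmono⟩
    have hm : Monotone (x ∘ σ) := by
      rw [Fin.monotone_iff_le_succ]
      intro k
      have h1 := hmono k.castSucc_lt_succ
      have h2 := hsep (σ k.succ) (σ k.castSucc) (σ.injective.ne k.castSucc_lt_succ.ne')
      simp only [Function.comp_apply] at h1 ⊢
      rw [abs_of_pos (by linarith)] at h2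
      simp only [key, Fin.val_succ, Fin.val_castSucc] at h2
      push_cast at h2
      linarith
    refine ⟨⟨fun i => ?_, fun i => ?_⟩,
      hm.strictMono_of_injective (hx.comp σ.injective)⟩
    · have h0 := (hI (σ 0)).1
      rw [key] at h0
      have h1 := hm (Fin.zero_le (σ.symm i))
      simp at h0 h1
      linarith
    · have h0 := (hI (σ (Fin.last n))).2
      rw [key] at h0
      have h1 := hm (Fin.le_last (σ.symm i))
      simp at h0 h1 ⊢
      linarith
  · rintro ⟨⟨hl, hu⟩, hmono⟩
    have hgap : ∀ k l, k < l → d ≤ (x (σ l) + d * (l : ℕ)) - (x (σ k) + d * (k : ℕ)) := by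
      intro k l hkl
      have h1 := hmono hkl
      have h2 : ((k : ℕ) : ℝ) + 1 ≤ (l : ℕ) := by exact_mod_cast hkl
      simp only [Function.comp_apply] at h1
      nlinarith
    refine ⟨⟨fun i => ?_, fun i j hij => ?_⟩, fun k l hkl => ?_⟩
    · obtain ⟨k, rfl⟩ := σ.surjective i
      rw [key]
      have h1 := hl (σ k)
      have h2 := hu (σ k)
      have h3 : ((k : ℕ) : ℝ) ≤ n := by exact_mod_cast Fin.is_le k
      have h4 : (0 : ℝ) ≤ (k : ℕ) := Nat.cast_nonneg _
      push_cast at h2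
      constructor <;> nlinarith
    · obtain ⟨k, rfl⟩ := σ.surjective i
      obtain ⟨l, rfl⟩ := σ.surjective j
      rw [key, key]
      rcases lt_or_gt_of_ne (fun h => hij (congrArg σ h) : k ≠ l) with h | h
      · rw [abs_sub_comm]
        exact (hgap k l h).trans (le_abs_self _)
      · exact (hgap l k h).trans (le_abs_self _)
    · have := hgap k l hkl
      simp only [Function.comp_apply, key]
      linarith

theorem volume_separated (n : ℕ) {d a b : ℝ} (hd : 0 < d) :
    volume (separated n d a b) = ENNReal.ofReal (b - a - ((n : ℝ) - 1) * d) ^ n := by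
  have hQ : volume (Set.Icc (fun _ : Fin n => a) (fun _ => b - ((n : ℝ) - 1) * d)) =
      ENNReal.ofReal (b - a - ((n : ℝ) - 1) * d) ^ n := by
    rw [Real.volume_Icc_pi, Finset.prod_const, Finset.card_univ, Fintype.card_fin]
    congr 2; ring
  rw [← hQ, volume_eq_sum_chamber (measurableSet_separated n d a b),
    volume_eq_sum_chamber measurableSet_Icc]
  refine Finset.sum_congr rfl fun σ _ => ?_
  rw [← measure_preimage_add_right volume (fun i => d * ((σ.symm i : ℕ) : ℝ))]
  refine measure_congr ?_
  filter_upwards [ae_injective n] with x hx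
  exact propext (add_mem_separated_iff hd σ hx)

theorem measurable_rotate (L t : ℝ) : Measurable (rotate L t) :=
  Measurable.ite measurableSet_Iio (by fun_prop) (by fun_prop)

theorem measurePreserving_rotate {L t : ℝ} (ht : t ∈ Set.Ico 0 L) :
    MeasurePreserving (rotate L t) (volume.restrict (Set.Ico 0 L))
      (volume.restrict (Set.Ico 0 L)) := by
  obtain ⟨h0, hL⟩ := ht
  refine ⟨measurable_rotate L t, Measure.ext fun s hs => ?_⟩
  rw [Measure.map_apply (measurable_rotate L t) hs,
    Measure.restrict_apply (measurable_rotate L t hs), Measure.restrict_apply hs,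
    ← measure_inter_add_sdiff (rotate L t ⁻¹' s ∩ Set.Ico 0 L) (measurableSet_Iio (a := t)),
    ← measure_inter_add_sdiff (s ∩ Set.Ico 0 L) (measurableSet_Ici (a := L - t)),
    ← measure_preimage_add_right volume (L - t) ((s ∩ Set.Ico 0 L) ∩ Set.Ici (L - t)),
    ← measure_preimage_add_right volume (-t) ((s ∩ Set.Ico 0 L) \ Set.Ici (L - t))]
  congr 2
  · ext x
    simp only [Set.mem_inter_iff, Set.mem_preimage, Set.mem_Ico, Set.mem_Iio, Set.mem_Ici, rotate]
    constructor
    · rintro ⟨⟨hs, h1, h2⟩, h3⟩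
      rw [if_pos h3] at hs
      exact ⟨⟨hs, by linarith, by linarith⟩, by linarith⟩
    · rintro ⟨⟨hs, h1, h2⟩, h3⟩
      have h4 : x < t := by linarith
      rw [if_pos h4]
      exact ⟨⟨hs, by linarith, by linarith⟩, h4⟩
  · ext x
    simp only [Set.mem_inter_iff, Set.mem_sdiff, Set.mem_preimage, Set.mem_Ico, Set.mem_Iio,
      Set.mem_Ici, rotate, not_lt, not_le]
    constructor
    · rintro ⟨⟨hs, h1, h2⟩, h3⟩
      rw [if_neg h3.not_gt] at hs
      exact ⟨⟨hs, by linarith, by linarith⟩, by linarith⟩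
    · rintro ⟨⟨hs, h1, h2⟩, h3⟩
      have h4 : t ≤ x := by linarith
      rw [if_neg h4.not_gt]
      exact ⟨⟨hs, by linarith, by linarith⟩, h4⟩

/-- Configurations on the circle at pairwise arc-length distance at least `d`. -/
def uncrowded (n : ℕ) (L d : ℝ) : Set (Fin n → ℝ) :=
  {θ | ∀ i j, i ≠ j → d ≤ min |θ i - θ j| (L - |θ i - θ j|)}

theorem measurableSet_uncrowded (n : ℕ) (L d : ℝ) : MeasurableSet (uncrowded n L d) := by
  unfold uncrowded
  measurability

theorem le_min_abs_iff_rotate_mem {L d t x : ℝ} (ht : t ∈ Set.Ico 0 L)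
    (hx : x ∈ Set.Ico 0 L) :
    d ≤ min |x - t| (L - |x - t|) ↔ rotate L t x ∈ Set.Icc d (L - d) := by
  obtain ⟨ht0, htL⟩ := ht
  obtain ⟨hx0, hxL⟩ := hx
  rw [le_min_iff, rotate, Set.mem_Icc]
  split_ifs with h
  · rw [abs_of_neg (by linarith)]
    constructor <;> rintro ⟨h1, h2⟩ <;> constructor <;> linarith
  · rw [abs_of_nonneg (by linarith)]
    constructor <;> rintro ⟨h1, h2⟩ <;> constructor <;> linarith

theorem le_min_abs_iff_rotate {L d t x y : ℝ} (hd : 0 < d)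
    (hx : x ∈ Set.Ico 0 L) (hy : y ∈ Set.Ico 0 L)
    (hx' : rotate L t x ∈ Set.Icc d (L - d)) (hy' : rotate L t y ∈ Set.Icc d (L - d)) :
    d ≤ min |x - y| (L - |x - y|) ↔ d ≤ |rotate L t x - rotate L t y| := by
  obtain ⟨hx0, hxL⟩ := hx
  obtain ⟨hy0, hyL⟩ := hy
  rw [Set.mem_Icc] at hx' hy'
  obtain ⟨h1, h2⟩ := hx'
  obtain ⟨h3, h4⟩ := hy'
  rw [le_min_iff]
  unfold rotate at *
  split_ifs at * with hxt hyt
  all_goals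
    constructor
    · rintro ⟨h5, h6⟩
      grind
    · intro h5
      constructor <;> grind

theorem insert_mem_uncrowded_iff {n : ℕ} {L d t : ℝ} (hd : 0 < d) (ht : t ∈ Set.Ico 0 L)
    {y : Fin n → ℝ} (hy : ∀ i, y i ∈ Set.Ico 0 L) :
    (Fin.cons t y : Fin (n + 1) → ℝ) ∈ uncrowded (n + 1) L d ↔
      (fun i => rotate L t (y i)) ∈ separated n d d (L - d) := by
  constructor
  · intro h
    have hI : ∀ i, rotate L t (y i) ∈ Set.Icc d (L - d) := fun i =>
      (le_min_abs_iff_rotate_mem ht (hy i)).1 (by simpa using h i.succ 0 (Fin.succ_ne_zero i))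
    refine ⟨hI, fun i j hij => ?_⟩
    exact (le_min_abs_iff_rotate hd (hy i) (hy j) (hI i) (hI j)).1
      (by simpa using h i.succ j.succ (by simpa using hij))
  · rintro ⟨hI, hsep⟩ i j hij
    induction i using Fin.cases with
    | zero =>
      induction j using Fin.cases with
      | zero => exact absurd rfl hij
      | succ j =>
        rw [abs_sub_comm]
        exact (le_min_abs_iff_rotate_mem ht (hy j)).2 (hI j)
    | succ i =>
      induction j using Fin.cases with
      | zero => exact (le_min_abs_iff_rotate_mem ht (hy i)).2 (hI i)
      | succ j =>
        exact (le_min_abs_iff_rotate hd (hy i) (hy j) (hI i) (hI j)).2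
          (hsep i j fun h => hij (congrArg Fin.succ h))

/-- The uniform probability measure on the circle of circumference `L`. -/
noncomputable abbrev uniform (L : ℝ) : Measure ℝ :=
  (ENNReal.ofReal L)⁻¹ • volume.restrict (Set.Ico (0 : ℝ) L)

theorem isProbabilityMeasure_uniform {L : ℝ} (hL : 0 < L) : IsProbabilityMeasure (uniform L) := by
  refine ⟨?_⟩
  simp only [Measure.smul_apply, Measure.restrict_apply_univ, Real.volume_Ico, sub_zero,
    smul_eq_mul]
  exact ENNReal.inv_mul_cancel (by simpa using hL) ENNReal.ofReal_ne_top

theorem ae_uniform_mem (L : ℝ) : ∀ᵐ x ∂uniform L, x ∈ Set.Ico 0 L :=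
  Measure.ae_smul_measure (ae_restrict_mem measurableSet_Ico) _

theorem pi_uniform {L : ℝ} (hL : 0 < L) (n : ℕ) :
    Measure.pi (fun _ : Fin n => uniform L) =
      (ENNReal.ofReal L)⁻¹ ^ n •
        volume.restrict (Set.univ.pi fun _ : Fin n => Set.Ico (0 : ℝ) L) := by
  have := isProbabilityMeasure_uniform hL
  refine Measure.pi_eq fun s _ => ?_
  rw [volume_pi, Measure.restrict_pi_pi]
  simp [Measure.pi_pi, Finset.prod_mul_distrib]

theorem pi_uniform_separated {L d : ℝ} (hL : 0 < L) (hd : 0 < d) (n : ℕ) :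
    Measure.pi (fun _ : Fin n => uniform L) (separated n d d (L - d)) =
      ENNReal.ofReal (1 - ((n + 1 : ℕ) : ℝ) * d / L) ^ n := by
  rw [pi_uniform hL, Measure.smul_apply, Measure.restrict_apply (measurableSet_separated _ _ _ _),
    Set.inter_eq_left.2, volume_separated n hd, smul_eq_mul, ← mul_pow, mul_comm,
    ← div_eq_mul_inv, ← ENNReal.ofReal_div_of_pos hL]
  · congr 2
    push_cast
    field_simp
    ring
  · intro x hx i _
    have := hx.1 i
    exact ⟨hd.le.trans this.1, this.2.trans_lt (by linarith)⟩

theorem pi_uniform_slice {L d t : ℝ} (hL : 0 < L) (hd : 0 < d) (ht : t ∈ Set.Ico 0 L) (n : ℕ) :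
    Measure.pi (fun _ : Fin n => uniform L)
        {y | (Fin.cons t y : Fin (n + 1) → ℝ) ∈ uncrowded (n + 1) L d} =
      ENNReal.ofReal (1 - ((n + 1 : ℕ) : ℝ) * d / L) ^ n := by
  have := isProbabilityMeasure_uniform hL
  have hrot := measurePreserving_pi (fun _ : Fin n => uniform L) (fun _ => uniform L)
    (fun _ => (measurePreserving_rotate ht).smul_measure (ENNReal.ofReal L)⁻¹)
  rw [← pi_uniform_separated hL hd,
    ← hrot.measure_preimage (measurableSet_separated n d d (L - d)).nullMeasurableSet]
  refine measure_congr ?_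
  have hmem : ∀ᵐ y ∂Measure.pi (fun _ : Fin n => uniform L), ∀ i, y i ∈ Set.Ico 0 L := by
    rw [ae_all_iff]
    exact fun i => (Measure.quasiMeasurePreserving_eval _ i).ae (ae_uniform_mem L)
  filter_upwards [hmem] with y hy
  exact propext (insert_mem_uncrowded_iff hd ht hy)

theorem pi_uniform_uncrowded {L d : ℝ} (hL : 0 < L) (hd : 0 < d) (n : ℕ) :
    Measure.pi (fun _ : Fin (n + 1) => uniform L) (uncrowded (n + 1) L d) =
      ENNReal.ofReal (1 - ((n + 1 : ℕ) : ℝ) * d / L) ^ n := by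
  have := isProbabilityMeasure_uniform hL
  have hpi := (measurePreserving_piFinSuccAbove (fun _ : Fin (n + 1) => uniform L) 0).symm
  have hU := measurableSet_uncrowded (n + 1) L d
  rw [← hpi.measure_preimage hU.nullMeasurableSet, Measure.prod_apply (hpi.measurable hU)]
  trans ∫⁻ _, ENNReal.ofReal (1 - ((n + 1 : ℕ) : ℝ) * d / L) ^ n ∂uniform L
  · refine lintegral_congr_ae ?_
    filter_upwards [ae_uniform_mem L] with t ht
    rw [← pi_uniform_slice hL hd ht n]
    congr 1
    ext y
    simp [MeasurableEquiv.piFinSuccAbove_symm_apply, Fin.insertNthEquiv]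
  · rw [lintegral_const, measure_univ, mul_one]

end UncrowdedRoad

/-- **Probability of an uncrowded road.** If `m ≥ 1` points are distributed independently and
uniformly on a circle of circumference `L` (modelled as `[0, L)` with the arc-length distance
`dist a b = min |a - b| (L - |a - b|)`), and `m * d ≤ L`, then the probability that every pair
of distinct points is at arc-length distance at least `d` equals `(1 - m * d / L) ^ (m - 1)`. -/
theorem uncrowded_road (L d : ℝ) (hL : 0 < L) (hd : 0 < d) (m : ℕ) (hm : 1 ≤ m)
    (hmd : (m : ℝ) * d ≤ L) :
    (Measure.pi (fun _ : Fin m =>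
        (ENNReal.ofReal L)⁻¹ • volume.restrict (Set.Ico (0 : ℝ) L)))
      {θ : Fin m → ℝ | ∀ i j : Fin m, i ≠ j →
        d ≤ min |θ i - θ j| (L - |θ i - θ j|)} =
    ENNReal.ofReal ((1 - (m : ℝ) * d / L) ^ (m - 1)) := by
  obtain ⟨n, rfl⟩ := Nat.exists_eq_add_of_le' hm
  have hnonneg : 0 ≤ 1 - ((n + 1 : ℕ) : ℝ) * d / L := sub_nonneg.2 ((div_le_one hL).2 hmd)
  rw [Nat.add_sub_cancel, ENNReal.ofReal_pow hnonneg]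
  exact UncrowdedRoad.pi_uniform_uncrowded hL hd n
end

section
/- Let ν be a nonzero Borel measure on ℂ, finite on compact sets, which is doubling: there is C_d > 0 with ν(D(z,2r)) ≤ C_d · ν(D(z,r)) for all z ∈ ℂ and r > 0. Let ρ : ℂ → ℝ satisfy: for every z ∈ ℂ and r > 0, ν(D(z,r)) < 1 if and only if r < ρ(z). Then for every r > 0 there exists C_r ≥ 1 such that whenever ζ ∈ D(z, r·ρ(z)), one has ρ(z)/C_r ≤ ρ(ζ) ≤ C_r · ρ(z). -/
open MeasureTheory

/-- Iterating the doubling inequality. -/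
theorem measure_ball_two_pow_mul_le {ν : Measure ℂ} {C : ℝ} (hC : 0 ≤ C)
    (hdb : ∀ (z : ℂ) (r : ℝ), 0 < r →
      ν (Metric.ball z (2 * r)) ≤ ENNReal.ofReal C * ν (Metric.ball z r))
    (n : ℕ) (z : ℂ) {r : ℝ} (hr : 0 < r) :
    ν (Metric.ball z (2 ^ n * r)) ≤ ENNReal.ofReal (C ^ n) * ν (Metric.ball z r) := by
  induction n with
  | zero => simp
  | succ n ih =>
    have h := hdb z (2 ^ n * r) (by positivity)
    rw [pow_succ', pow_succ', mul_assoc, ENNReal.ofReal_mul hC, mul_assoc]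
    exact h.trans (by gcongr)

/-- A doubling measure on the plane is reverse doubling. -/
theorem reverse_doubling {ν : Measure ℂ} {C : ℝ} (hC : 0 < C)
    (hdb : ∀ (z : ℂ) (r : ℝ), 0 < r →
      ν (Metric.ball z (2 * r)) ≤ ENNReal.ofReal C * ν (Metric.ball z r))
    (z : ℂ) {r : ℝ} (hr : 0 < r) :
    ENNReal.ofReal (1 + (C ^ 2)⁻¹) * ν (Metric.ball z r) ≤ ν (Metric.ball z (4 * r)) := by
  obtain ⟨w, hw⟩ : ∃ w : ℂ, dist w z = 2 * r :=
    ⟨z + (2 * r : ℝ), by rw [dist_eq_norm, add_sub_cancel_left, Complex.norm_real,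
      Real.norm_of_nonneg (by positivity)]⟩
  have hcover : ν (Metric.ball z r) ≤ ENNReal.ofReal (C ^ 2) * ν (Metric.ball w r) :=
    (measure_mono (Metric.ball_subset_ball' (by rw [dist_comm, hw]; linarith))).trans
      (measure_ball_two_pow_mul_le hC.le hdb 2 w hr)
  have hscaled : ENNReal.ofReal (C ^ 2)⁻¹ * ν (Metric.ball z r) ≤ ν (Metric.ball w r) := by
    calc ENNReal.ofReal (C ^ 2)⁻¹ * ν (Metric.ball z r)
        ≤ ENNReal.ofReal (C ^ 2)⁻¹ * (ENNReal.ofReal (C ^ 2) * ν (Metric.ball w r)) := by gcongr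
      _ = ν (Metric.ball w r) := by
        rw [← mul_assoc, ← ENNReal.ofReal_mul (by positivity),
          inv_mul_cancel₀ (by positivity), ENNReal.ofReal_one, one_mul]
  have hdisj : Disjoint (Metric.ball z r) (Metric.ball w r) :=
    Metric.ball_disjoint_ball (by rw [dist_comm, hw]; linarith)
  calc ENNReal.ofReal (1 + (C ^ 2)⁻¹) * ν (Metric.ball z r)
      = ν (Metric.ball z r) + ENNReal.ofReal (C ^ 2)⁻¹ * ν (Metric.ball z r) := by
        rw [ENNReal.ofReal_add zero_le_one (by positivity), add_mul, ENNReal.ofReal_one, one_mul]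
    _ ≤ ν (Metric.ball z r) + ν (Metric.ball w r) := by gcongr
    _ = ν (Metric.ball z r ∪ Metric.ball w r) :=
        (measure_union hdisj measurableSet_ball).symm
    _ ≤ ν (Metric.ball z (4 * r)) := measure_mono (Set.union_subset
        (Metric.ball_subset_ball (by linarith)) (Metric.ball_subset_ball' (by rw [hw]; linarith)))

/-- Iterating the reverse doubling inequality. -/
theorem reverse_doubling_pow {ν : Measure ℂ} {C : ℝ} (hC : 0 < C)
    (hdb : ∀ (z : ℂ) (r : ℝ), 0 < r →
      ν (Metric.ball z (2 * r)) ≤ ENNReal.ofReal C * ν (Metric.ball z r))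
    (n : ℕ) (z : ℂ) {r : ℝ} (hr : 0 < r) :
    ENNReal.ofReal ((1 + (C ^ 2)⁻¹) ^ n) * ν (Metric.ball z r) ≤
      ν (Metric.ball z (4 ^ n * r)) := by
  induction n with
  | zero => simp
  | succ n ih =>
    rw [pow_succ' (1 + _) n, pow_succ' 4 n, mul_assoc 4, ENNReal.ofReal_mul (by positivity), mul_assoc]
    refine le_trans ?_ (reverse_doubling hC hdb z (by positivity : 0 < 4 ^ n * r))
    gcongr

/-- If `ν` is a nonzero doubling Borel measure on `ℂ`, finite on compact sets, and `ρ(z)` is the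
radius for which the disk centered at `z` has `ν`-measure exactly 1, then for every `r > 0`
there is `C_r ≥ 1` such that `ρ(z)/C_r ≤ ρ(ζ) ≤ C_r ρ(z)` whenever `ζ ∈ D(z, r ρ(z))`. -/
theorem rho_comparable (ν : Measure ℂ) (hν0 : ν ≠ 0)
    (hνfin : ∀ K : Set ℂ, IsCompact K → ν K < ⊤)
    (C_d : ℝ) (hCd : 0 < C_d)
    (hdb : ∀ (z : ℂ) (r : ℝ), 0 < r →
      ν (Metric.ball z (2 * r)) ≤ ENNReal.ofReal C_d * ν (Metric.ball z r))
    (ρ : ℂ → ℝ)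
    (hρ : ∀ (z : ℂ) (r : ℝ), 0 < r → (ν (Metric.ball z r) < 1 ↔ r < ρ z)) :
    ∀ r : ℝ, 0 < r → ∃ C : ℝ, 1 ≤ C ∧
      ∀ z ζ : ℂ, ζ ∈ Metric.ball z (r * ρ z) → ρ z / C ≤ ρ ζ ∧ ρ ζ ≤ C * ρ z := by
  intro r hr
  obtain ⟨n, hn⟩ := pow_unbounded_of_one_lt (2 * (1 + r)) (one_lt_two : (1 : ℝ) < 2)
  obtain ⟨m, hm⟩ := pow_unbounded_of_one_lt (C_d ^ n)
    (lt_add_of_pos_right 1 (by positivity) : (1 : ℝ) < 1 + (C_d ^ 2)⁻¹)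
  have h4 : (1 : ℝ) ≤ 4 ^ m := one_le_pow₀ (by norm_num)
  refine ⟨4 ^ m * (1 + r), by nlinarith, fun z ζ hζ => ?_⟩
  have hR : 0 < ρ z := (pos_iff_pos_of_mul_pos (Metric.pos_of_mem_ball hζ)).1 hr
  rw [Metric.mem_ball] at hζ
  constructor
  · have hle : ρ z / (4 ^ m * (1 + r)) ≤ ρ z / 4 ^ m := by
      gcongr
      nlinarith
    refine hle.trans ?_
    by_contra! hlt
    have hone : 1 ≤ ν (Metric.ball ζ (ρ z / 4 ^ m)) :=
      not_lt.1 fun h => hlt.not_gt ((hρ ζ _ (by positivity)).1 h)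
    have hhalf : ν (Metric.ball z (ρ z / 2)) < 1 := (hρ z _ (by positivity)).2 (by linarith)
    have hchain : ENNReal.ofReal ((1 + (C_d ^ 2)⁻¹) ^ m) ≤ ENNReal.ofReal (C_d ^ n) :=
      calc ENNReal.ofReal ((1 + (C_d ^ 2)⁻¹) ^ m)
          ≤ ENNReal.ofReal ((1 + (C_d ^ 2)⁻¹) ^ m) * ν (Metric.ball ζ (ρ z / 4 ^ m)) :=
            le_mul_of_one_le_right' hone
        _ ≤ ν (Metric.ball ζ (4 ^ m * (ρ z / 4 ^ m))) :=
            reverse_doubling_pow hCd hdb m ζ (by positivity)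
        _ ≤ ν (Metric.ball z (2 ^ n * (ρ z / 2))) := by
            refine measure_mono (Metric.ball_subset_ball' ?_)
            rw [mul_div_cancel₀ _ (by positivity)]
            nlinarith
        _ ≤ ENNReal.ofReal (C_d ^ n) * ν (Metric.ball z (ρ z / 2)) :=
            measure_ball_two_pow_mul_le hCd.le hdb n z (by positivity)
        _ ≤ ENNReal.ofReal (C_d ^ n) := mul_le_of_le_one_right' hhalf.le
    exact hm.not_ge ((ENNReal.ofReal_le_ofReal_iff (by positivity)).1 hchain)
  · have hone : 1 ≤ ν (Metric.ball z (ρ z)) :=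
      not_lt.1 fun h => lt_irrefl _ ((hρ z _ hR).1 h)
    have hbound : ρ ζ ≤ (1 + r) * ρ z := by
      by_contra! hlt
      refine ((hρ ζ _ (by positivity)).2 hlt).not_ge (hone.trans ?_)
      refine measure_mono (Metric.ball_subset_ball' ?_)
      rw [dist_comm]
      linarith
    calc ρ ζ ≤ (1 + r) * ρ z := hbound
      _ ≤ 4 ^ m * ((1 + r) * ρ z) := le_mul_of_one_le_left (by positivity) h4
      _ = 4 ^ m * (1 + r) * ρ z := (mul_assoc _ _ _).symm
end
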